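/- For all integers i, j ≥ 1, the quadratic operators of the b-deformed bipartite map (at-most-bivalent) model satisfy [M⁽²⁾_i, M⁽²⁾_j] = (i−j) · M⁽²⁾_{i+j−2}, with the convention M⁽²⁾₀ = 0; that is, the operators M⁽²⁾_i span a shifted half-Virasoro algebra, for every value of the deformation parameter b and of the vertex weight u. -/

import Mathlib

noncomputable section

/-- The polynomial ring `K[p₁, p₂, …]`, with one variable `p_i` for each positive integer. -/
abbrev Rp (K : Type) [Field K] : Type := MvPolynomial ℕ+ K

/-- The partial derivative `∂/∂p_i` as a `K`-linear endomorphism (junk value `0` for `i = 0`). -/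
def pderivN (K : Type) [Field K] (i : ℕ) : Module.End K (Rp K) :=
  if h : 0 < i then (MvPolynomial.pderiv (⟨i, h⟩ : ℕ+)).toLinearMap else 0

/-- Multiplication by the variable `p_i` (junk value `0` for `i = 0`). -/
def mulpN (K : Type) [Field K] (i : ℕ) : Module.End K (Rp K) :=
  if h : 0 < i then LinearMap.mulLeft K (MvPolynomial.X (⟨i, h⟩ : ℕ+)) else 0

/-- The operator `p_i^* = i·∂/∂p_i`. -/
def pstar (K : Type) [Field K] (i : ℕ) : Module.End K (Rp K) :=
  (i : K) • pderivN K i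

/-- The currents with `J₀ = 0`: `J_{−k}` is multiplication by `p_k` and
`J_k = (1+b)·k·∂/∂p_k` for `k ≥ 1`. -/
def Jop (K : Type) [Field K] (b : K) (m : ℤ) : Module.End K (Rp K) :=
  if 0 < m then ((1 + b) * (m : K)) • pderivN K m.toNat else mulpN K (-m).toNat

/-- The currents of the bipartite-map model: as `Jop`, except that `J₀ = u·id`. -/
def JopU (K : Type) [Field K] (b u : K) (m : ℤ) : Module.End K (Rp K) :=
  if m = 0 then u • (1 : Module.End K (Rp K)) else Jop K b m

section

variable {K : Type} [Field K]

theorem pderivN_pnat (k : ℕ+) :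
    pderivN K (k : ℕ) = (MvPolynomial.pderiv k : Derivation K (Rp K) (Rp K)).toLinearMap := by
  exact dif_pos k.pos

theorem mulpN_pnat (k : ℕ+) :
    mulpN K (k : ℕ) = LinearMap.mulLeft K (MvPolynomial.X k : Rp K) := by
  exact dif_pos k.pos

theorem JopU_zero (b u : K) (f : Rp K) : JopU K b u 0 f = u • f := by
  simp [JopU]

theorem JopU_pnat (b u : K) (k : ℕ+) (f : Rp K) :
    JopU K b u ((k : ℕ) : ℤ) f = ((1 + b) * ((k : ℕ) : K)) • MvPolynomial.pderiv k f := by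
  have hk : ((k : ℕ) : ℤ) ≠ 0 := by exact_mod_cast k.ne_zero
  have hk' : 0 < ((k : ℕ) : ℤ) := by exact_mod_cast k.pos
  rw [JopU, if_neg hk, Jop, if_pos hk', Int.toNat_natCast, pderivN_pnat]
  simp

theorem JopU_neg_pnat (b u : K) (k : ℕ+) (f : Rp K) :
    JopU K b u (-((k : ℕ) : ℤ)) f = MvPolynomial.X k * f := by
  have hk : (-((k : ℕ) : ℤ)) ≠ 0 := by simp
  have hk' : ¬ 0 < -((k : ℕ) : ℤ) := by simp
  rw [JopU, if_neg hk, Jop, if_neg hk', neg_neg, Int.toNat_natCast, mulpN_pnat]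
  rfl

theorem JopU_one_of_pos (b u : K) {n : ℤ} (hn : 0 < n) : JopU K b u n 1 = 0 := by
  lift n to ℕ using hn.le
  have h := JopU_pnat b u (⟨n, by exact_mod_cast hn⟩ : ℕ+) 1
  rwa [Derivation.map_one_eq_zero, smul_zero] at h

theorem pderiv_comm (k l : ℕ+) (f : Rp K) :
    MvPolynomial.pderiv k (MvPolynomial.pderiv l f) =
      MvPolynomial.pderiv l (MvPolynomial.pderiv k f) := by
  have h : ⁅(MvPolynomial.pderiv k : Derivation K (Rp K) (Rp K)),
      (MvPolynomial.pderiv l : Derivation K (Rp K) (Rp K))⁆ = 0 := by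
    refine MvPolynomial.derivation_ext (R := K) fun m => ?_
    simp [Derivation.commutator_apply, MvPolynomial.pderiv_X, Pi.single_apply, apply_ite]
  have := DFunLike.congr_fun h f
  rwa [Derivation.commutator_apply, Derivation.zero_apply, sub_eq_zero] at this

theorem exists_pnat_of_int (n : ℤ) :
    n = 0 ∨ (∃ k : ℕ+, n = ((k : ℕ) : ℤ)) ∨ ∃ k : ℕ+, n = -((k : ℕ) : ℤ) := by
  rcases lt_trichotomy n 0 with h | h | h
  · exact .inr (.inr ⟨⟨n.natAbs, by omega⟩, show n = -(n.natAbs : ℤ) by omega⟩)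
  · exact .inl h
  · exact .inr (.inl ⟨⟨n.natAbs, by omega⟩, show n = (n.natAbs : ℤ) by omega⟩)

/-- The Heisenberg relation `[J_m, J_n] = (1+b)·m·δ_{m+n,0}`. -/
theorem JopU_comm (b u : K) (m n : ℤ) (f : Rp K) :
    JopU K b u m (JopU K b u n f) = JopU K b u n (JopU K b u m f) +
      (if m + n = 0 then (1 + b) * (m : K) else 0) • f := by
  have key (k l : ℕ+) : JopU K b u ((k : ℕ) : ℤ) (JopU K b u (-((l : ℕ) : ℤ)) f) =
      JopU K b u (-((l : ℕ) : ℤ)) (JopU K b u ((k : ℕ) : ℤ) f) +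
        (if k = l then (1 + b) * ((k : ℕ) : K) else 0) • f := by
    simp only [JopU_pnat, JopU_neg_pnat, Derivation.leibniz, MvPolynomial.pderiv_X,
      smul_eq_mul, smul_add, mul_smul_comm, Pi.single_apply]
    by_cases h : k = l <;> simp [h, eq_comm]
  rcases exists_pnat_of_int m with rfl | ⟨k, rfl⟩ | ⟨k, rfl⟩ <;>
    rcases exists_pnat_of_int n with rfl | ⟨l, rfl⟩ | ⟨l, rfl⟩
  · simp
  · simp [JopU_zero]
  · simp [JopU_zero]
  · simp [JopU_zero]
  · have h : ((k : ℕ) : ℤ) + ((l : ℕ) : ℤ) ≠ 0 := by have := k.pos; omega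
    simp only [JopU_pnat, if_neg h, zero_smul, add_zero, map_smul, pderiv_comm k l]
    rw [smul_comm]
  · rw [key]
    simp only [add_neg_eq_zero, Nat.cast_inj, PNat.coe_inj, Int.cast_natCast]
  · simp [JopU_zero]
  · rw [key]
    by_cases h : l = k
    · subst h
      simp [add_assoc]
    · have h' : -((k : ℕ) : ℤ) + ((l : ℕ) : ℤ) ≠ 0 := by
        rw [neg_add_eq_sub, sub_ne_zero]
        simpa using h
      rw [if_neg h, if_neg h']
      simp
  · have h : -((k : ℕ) : ℤ) + -((l : ℕ) : ℤ) ≠ 0 := by have := k.pos; omega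
    simp only [JopU_neg_pnat, if_neg h, zero_smul, add_zero]
    ring

/-- `L` is the locally finite operator
`(1+b)⁻¹ (Σ_{k≥0} J_{a−k} J_k + b(a+1) J_a)`. -/
def IsQuadratic (b u : K) (a : ℤ) (L : Module.End K (Rp K)) : Prop :=
  ∀ f, ∃ N₀ : ℕ, ∀ N, N₀ ≤ N → L f = (1 + b)⁻¹ •
    (∑ k ∈ Finset.range N, JopU K b u (a - k) (JopU K b u k f) +
      (b * ((a : K) + 1)) • JopU K b u a f)

theorem sum_range_delta (N : ℕ) (n : ℤ) (hn : n < N) (g : ℤ → Rp K) :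
    ∑ k ∈ Finset.range N, (if (k : ℤ) = n then g k else 0) = if 0 ≤ n then g n else 0 := by
  split_ifs with h
  · lift n to ℕ using h
    simp only [Nat.cast_inj]
    rw [Finset.sum_ite_eq' (Finset.range N) n (fun k : ℕ => g k), if_pos]
    simpa using hn
  · refine Finset.sum_eq_zero fun k _ => if_neg ?_
    omega

theorem IsQuadratic.lie_JopU {b u : K} (hb : (1 : K) + b ≠ 0) {a : ℤ} {L : Module.End K (Rp K)}
    (hL : IsQuadratic b u a L) (n : ℤ) :
    ⁅L, JopU K b u n⁆ =
      (-(n : K) * ((if n ≤ 0 then 1 else 0) + if 0 ≤ a + n then 1 else 0)) • JopU K b u (a + n) +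
        (if a + n = 0 then -(b * ((a : K) + 1) * n) else 0) • (1 : Module.End K (Rp K)) := by
  refine LinearMap.ext fun f => ?_
  obtain ⟨N₁, h₁⟩ := hL f
  obtain ⟨N₂, h₂⟩ := hL (JopU K b u n f)
  obtain ⟨N, hN₁, hN₂, hN₃, hN₄⟩ :
      ∃ N : ℕ, N₁ ≤ N ∧ N₂ ≤ N ∧ -n < (N : ℤ) ∧ a + n < (N : ℤ) :=
    ⟨N₁ + N₂ + n.natAbs + (a + n).natAbs + 1, by omega, by omega, by omega, by omega⟩
  have hterm (k : ℕ) : JopU K b u (a - k) (JopU K b u k (JopU K b u n f)) =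
      JopU K b u n (JopU K b u (a - k) (JopU K b u k f)) +
        ((if (k : ℤ) = -n then ((1 + b) * -(n : K)) • JopU K b u (a + n) f else 0) +
        (if (k : ℤ) = a + n then ((1 + b) * -(n : K)) • JopU K b u (a + n) f else 0)) := by
    rw [JopU_comm b u k n f, map_add, map_smul, JopU_comm b u (a - k) n]
    have e₁ : ((k : ℤ) + n = 0) ↔ (k : ℤ) = -n := by omega
    have e₂ : (a - (k : ℤ) + n = 0) ↔ (k : ℤ) = a + n := by omega
    rw [add_assoc, add_comm (_ • _ : Rp K)]
    simp only [e₁, e₂]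
    congr 2
    · split_ifs with h
      · have : (k : K) = -(n : K) := by exact_mod_cast congrArg (Int.cast : ℤ → K) h
        rw [h, Int.cast_neg, sub_neg_eq_add]
      · simp
    · split_ifs with h
      · have : ((a - k : ℤ) : K) = -(n : K) := by
          rw [h]; push_cast; ring
        rw [this, h]
      · simp
  have hs₁ := sum_range_delta N (-n) hN₃
    (fun _ => ((1 + b) * -(n : K)) • JopU K b u (a + n) f)
  have hs₂ := sum_range_delta N (a + n) hN₄
    (fun _ => ((1 + b) * -(n : K)) • JopU K b u (a + n) f)
  rw [Ring.lie_def, LinearMap.sub_apply, Module.End.mul_apply, Module.End.mul_apply,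
    h₁ N hN₁, h₂ N hN₂, map_smul, map_add, map_sum, map_smul, JopU_comm b u a n f]
  simp only [hterm, Finset.sum_add_distrib, hs₁, hs₂, LinearMap.add_apply, LinearMap.smul_apply,
    Module.End.one_apply, Left.nonneg_neg_iff]
  by_cases h0 : a + n = 0
  · have ha : (a : K) = -n := by
      rw [← Int.cast_neg]; congr 1; omega
    simp only [h0, le_refl, if_true]
    split_ifs <;> rw [ha] <;> match_scalars <;> field_simp <;> ring
  · simp only [h0, if_false]
    split_ifs <;> match_scalars <;> field_simp <;> ring

theorem IsQuadratic.apply_one {b u : K} {a : ℤ} {L : Module.End K (Rp K)}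
    (hL : IsQuadratic b u a L) :
    L 1 = ((1 + b)⁻¹ * (u + b * ((a : K) + 1))) • JopU K b u a 1 := by
  obtain ⟨N, h⟩ := hL 1
  rw [h (N + 1) (by omega), Finset.sum_range_succ', Finset.sum_eq_zero]
  · simp only [Nat.cast_zero, sub_zero, JopU_zero, map_smul]
    module
  · intro k _
    rw [JopU_one_of_pos b u (by positivity), map_zero]

theorem eq_zero_of_lie_eq_zero (b u : K) {T : Module.End K (Rp K)} (h1 : T 1 = 0)
    (hT : ∀ n : ℤ, n < 0 → ⁅T, JopU K b u n⁆ = 0) : T = 0 := by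
  refine LinearMap.ext fun f => ?_
  induction f using MvPolynomial.induction_on with
  | C r => rw [← mul_one (MvPolynomial.C r), ← MvPolynomial.smul_eq_C_mul, map_smul, h1]; simp
  | add p q hp hq => rw [map_add, hp, hq]; simp
  | mul_X p k hp =>
    have h := LinearMap.congr_fun (hT (-((k : ℕ) : ℤ)) (by simp)) p
    rw [Ring.lie_def, LinearMap.sub_apply, Module.End.mul_apply, Module.End.mul_apply, hp,
      JopU_neg_pnat, LinearMap.zero_apply, map_zero, sub_zero] at h
    rw [mul_comm, h, LinearMap.zero_apply]

theorem lie_lie_end (A B X : Module.End K (Rp K)) : ⁅⁅A, B⁆, X⁆ = ⁅A, ⁅B, X⁆⁆ - ⁅B, ⁅A, X⁆⁆ := by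
  simp only [Ring.lie_def, sub_mul, mul_sub, mul_assoc]
  abel

theorem lie_smul_add_smul_one (A X : Module.End K (Rp K)) (r t : K) :
    ⁅A, r • X + t • (1 : Module.End K (Rp K))⁆ = r • ⁅A, X⁆ := by
  simp [Ring.lie_def, mul_add, add_mul, smul_sub]

theorem shift_mul_weight {a a' n : ℤ} (ha : -1 ≤ a) (hn : n < 0) :
    ((a' + n : ℤ) : K) * ((if n ≤ 0 then 1 else 0) + if 0 ≤ a' + n then 1 else 0) *
        ((if a' + n ≤ 0 then 1 else 0) + if 0 ≤ a + a' + n then 1 else 0) =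
      ((a' + n : ℤ) : K) * ((if n ≤ 0 then 1 else 0) + if 0 ≤ a + a' + n then 1 else 0) := by
  rw [if_pos hn.le]
  rcases lt_trichotomy (a' + n) 0 with h | h | h
  · rw [if_neg h.not_ge, if_pos h.le]
    ring
  · simp [h]
  · rw [if_pos h.le, if_neg h.not_ge, if_pos (by omega)]
    ring

theorem central_mul_weight {a a' n : ℤ} (ha : -1 ≤ a) (hn : n < 0) (h : a + a' + n = 0) :
    ((a : K) * (a + 1)) * ((if n ≤ 0 then 1 else 0) + if 0 ≤ a' + n then 1 else 0) =
      (a : K) * (a + 1) := by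
  rw [if_pos hn.le]
  rcases (by omega : a = -1 ∨ a = 0 ∨ 0 < a) with rfl | rfl | h'
  · simp
  · simp
  · rw [if_neg (by omega)]
    ring

theorem IsQuadratic.lie_lie_JopU {b u : K} (hb : (1 : K) + b ≠ 0) {a a' : ℤ} (ha : -1 ≤ a)
    (ha' : -1 ≤ a') {A B C : Module.End K (Rp K)} (hA : IsQuadratic b u a A)
    (hB : IsQuadratic b u a' B) (hC : IsQuadratic b u (a + a') C) {n : ℤ} (hn : n < 0) :
    ⁅⁅A, B⁆, JopU K b u n⁆ = ((a : K) - a') • ⁅C, JopU K b u n⁆ := by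
  rw [lie_lie_end, hA.lie_JopU hb n, hB.lie_JopU hb n, hC.lie_JopU hb n,
    lie_smul_add_smul_one, lie_smul_add_smul_one, hA.lie_JopU hb (a' + n),
    hB.lie_JopU hb (a + n), show a + (a' + n) = a + a' + n by ring,
    show a' + (a + n) = a + a' + n by ring]
  have w₁ := shift_mul_weight (K := K) (a' := a') ha hn
  have w₂ := shift_mul_weight (K := K) (a' := a) ha' hn
  rw [add_comm a' a] at w₂
  generalize hw₁ : ((if n ≤ 0 then 1 else 0) + if 0 ≤ a' + n then 1 else 0 : K) = x₁ at *
  generalize hw₂ : ((if n ≤ 0 then 1 else 0) + if 0 ≤ a + n then 1 else 0 : K) = x₂ at *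
  generalize ((if a' + n ≤ 0 then 1 else 0) + if 0 ≤ a + a' + n then 1 else 0 : K) = y₁ at *
  generalize ((if a + n ≤ 0 then 1 else 0) + if 0 ≤ a + a' + n then 1 else 0 : K) = y₂ at *
  generalize ((if n ≤ 0 then 1 else 0) + if 0 ≤ a + a' + n then 1 else 0 : K) = z at *
  push_cast at w₁ w₂ ⊢
  match_scalars
  · linear_combination (n : K) * w₁ - (n : K) * w₂
  · by_cases h : a + a' + n = 0
    · have c₁ := central_mul_weight (K := K) ha hn h
      have c₂ := central_mul_weight (K := K) (a' := a) ha' hn (by omega)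
      rw [hw₁] at c₁
      rw [hw₂] at c₂
      have hn' : (n : K) = -a - a' := by
        exact_mod_cast congrArg (Int.cast : ℤ → K) (by omega : n = -a - a')
      simp only [h, if_true, hn']
      linear_combination (b * (a + a')) * c₁ - (b * (a + a')) * c₂
    · simp [h]

theorem IsQuadratic.lie_apply_one {b u : K} (hb : (1 : K) + b ≠ 0) {a a' : ℤ} (ha : -1 ≤ a)
    (ha' : -1 ≤ a') {A B C : Module.End K (Rp K)} (hA : IsQuadratic b u a A)
    (hB : IsQuadratic b u a' B) (hC : IsQuadratic b u (a + a') C) :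
    ⁅A, B⁆ 1 = ((a : K) - a') • C 1 := by
  have hAJ := LinearMap.congr_fun (hA.lie_JopU hb a') 1
  have hBJ := LinearMap.congr_fun (hB.lie_JopU hb a) 1
  rw [Ring.lie_def, LinearMap.sub_apply, Module.End.mul_apply, Module.End.mul_apply,
    sub_eq_iff_eq_add, hA.apply_one, map_smul] at hAJ
  rw [Ring.lie_def, LinearMap.sub_apply, Module.End.mul_apply, Module.End.mul_apply,
    sub_eq_iff_eq_add, hB.apply_one, map_smul, JopU_comm b u a a', add_comm a' a] at hBJ
  rw [Ring.lie_def, LinearMap.sub_apply, Module.End.mul_apply, Module.End.mul_apply,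
    hA.apply_one, hB.apply_one, hC.apply_one, map_smul, map_smul, hAJ, hBJ]
  simp only [LinearMap.add_apply, LinearMap.smul_apply, Module.End.one_apply]
  rcases lt_or_ge 0 (a + a') with h | h
  · simp only [JopU_one_of_pos b u h, h.ne', if_false, smul_zero, zero_smul, add_zero, zero_add]
    module
  · obtain ⟨rfl, rfl⟩ | ⟨rfl, rfl⟩ | ⟨rfl, rfl⟩ | ⟨rfl, rfl⟩ | ⟨rfl, rfl⟩ | ⟨rfl, rfl⟩ :
        (a = -1 ∧ a' = -1) ∨ (a = -1 ∧ a' = 0) ∨ (a = 0 ∧ a' = -1) ∨ (a = 0 ∧ a' = 0) ∨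
          (a = -1 ∧ a' = 1) ∨ (a = 1 ∧ a' = -1) := by omega
    all_goals
      norm_num [JopU_zero]
      try match_scalars <;> field_simp <;> ring

theorem IsQuadratic.lie {b u : K} (hb : (1 : K) + b ≠ 0) {a a' : ℤ} (ha : -1 ≤ a)
    (ha' : -1 ≤ a') {A B C : Module.End K (Rp K)} (hA : IsQuadratic b u a A)
    (hB : IsQuadratic b u a' B) (hC : IsQuadratic b u (a + a') C) :
    ⁅A, B⁆ = ((a : K) - a') • C := by
  rw [← sub_eq_zero]
  refine eq_zero_of_lie_eq_zero b u ?_ fun n hn => ?_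
  · rw [LinearMap.sub_apply, hA.lie_apply_one hb ha ha' hB hC, LinearMap.smul_apply, sub_self]
  · have h := hA.lie_lie_JopU hb ha ha' hB hC hn
    rw [← sub_eq_zero] at h
    rw [← h]
    simp only [Ring.lie_def, sub_mul, mul_sub, smul_mul_assoc, mul_smul_comm, smul_sub]
    abel

end

/--
**Shifted half-Virasoro algebra for the quadratic operators of `b`-deformed bipartite maps
with vertices of degree at most two.**
Given the operators `M⁽ᵐ⁾_i` on `R = K[p₁, p₂, …]` determined by
`M⁽¹⁾_i = (1+b)⁻¹·J_{i−1}` for `i ≥ 1`, `M⁽ᵐ⁾₀ = 0` for `m ≥ 1`, and the (locally finite)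
recursion `M⁽ᵐ⁺¹⁾_i = Σ_{n≥1} J_{i−n−1} ∘ M⁽ᵐ⁾_n + b(i−1)·M⁽ᵐ⁾_{i−1}` for `i ≥ 1`,
one has `[M⁽²⁾_i, M⁽²⁾_j] = (i−j)·M⁽²⁾_{i+j−2}` for all `i, j ≥ 1` (with the convention
`M⁽²⁾₀ = 0`), for every value of the deformation parameter `b` and of the vertex weight `u`.
-/
theorem stmt_12 {K : Type} [Field K] [CharZero K] (b u : K) (hb : (1 : K) + b ≠ 0)
    (Mv : ℕ → ℕ → Module.End K (Rp K))
    (hbase1 : ∀ i : ℕ, 1 ≤ i → Mv 1 i = ((1 : K) + b)⁻¹ • JopU K b u ((i : ℤ) - 1))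
    (hbase0 : ∀ m : ℕ, 1 ≤ m → Mv m 0 = 0)
    (hfin : ∀ (m i : ℕ) (f : Rp K),
      (Set.Ici 1 ∩ Function.support fun n : ℕ =>
        (JopU K b u ((i : ℤ) - (n : ℤ) - 1)) ((Mv m n) f)).Finite)
    (hrec : ∀ m : ℕ, 1 ≤ m → ∀ i : ℕ, 1 ≤ i → ∀ f : Rp K,
      (Mv (m + 1) i) f =
        (∑ᶠ n ∈ Set.Ici (1 : ℕ), (JopU K b u ((i : ℤ) - (n : ℤ) - 1)) ((Mv m n) f)) +
          (b * ((i : K) - 1)) • (Mv m (i - 1)) f) :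
    ∀ i j : ℕ, 1 ≤ i → 1 ≤ j →
      ⁅Mv 2 i, Mv 2 j⁆ = ((i : K) - (j : K)) • Mv 2 (i + j - 2) := by
  have hquad (i : ℕ) (hi : 1 ≤ i) : IsQuadratic b u ((i : ℤ) - 2) (Mv 2 i) := by
    intro f
    obtain ⟨M, hM⟩ := (hfin 1 i f).bddAbove
    refine ⟨M, fun N hN => ?_⟩
    have hlin : (b * ((i : K) - 1)) • Mv 1 (i - 1) f =
        (1 + b)⁻¹ • (b * ((((i : ℤ) - 2 : ℤ) : K) + 1)) • JopU K b u ((i : ℤ) - 2) f := by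
      rcases hi.eq_or_lt with rfl | hi
      · norm_num
      · rw [hbase1 (i - 1) (by omega), LinearMap.smul_apply, smul_comm,
          show (((i - 1 : ℕ) : ℤ) - 1) = (i : ℤ) - 2 by omega,
          show (((i : ℤ) - 2 : ℤ) : K) + 1 = (i : K) - 1 by push_cast; ring]
    have hsum : (∑ᶠ n ∈ Set.Ici (1 : ℕ), JopU K b u ((i : ℤ) - (n : ℤ) - 1) (Mv 1 n f)) =
        (1 + b)⁻¹ • ∑ k ∈ Finset.range N,
          JopU K b u ((i : ℤ) - 2 - k) (JopU K b u k f) := by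
      rw [finsum_mem_eq_sum_of_inter_support_eq (t := Finset.Ico 1 (N + 1)),
        Finset.sum_Ico_eq_sum_range, Nat.add_sub_cancel, Finset.smul_sum]
      · refine Finset.sum_congr rfl fun k _ => ?_
        rw [hbase1 (1 + k) (by omega), LinearMap.smul_apply, map_smul,
          show ((1 + k : ℕ) : ℤ) - 1 = k by push_cast; ring,
          show (i : ℤ) - ((1 + k : ℕ) : ℤ) - 1 = (i : ℤ) - 2 - k by push_cast; ring]
      · ext n
        simp only [Set.mem_inter_iff, Set.mem_Ici, Finset.coe_Ico, Set.mem_Ico]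
        refine ⟨fun h => ⟨⟨h.1, ?_⟩, h.2⟩, fun h => ⟨h.1.1, h.2⟩⟩
        have := hM h
        omega
    rw [hrec 1 le_rfl i hi f, hlin, hsum, ← smul_add]
  intro i j hi hj
  rcases eq_or_ne i j with rfl | hij
  · simp [Ring.lie_def]
  · have hC := hquad (i + j - 2) (by omega)
    rw [show ((i + j - 2 : ℕ) : ℤ) - 2 = ((i : ℤ) - 2) + ((j : ℤ) - 2) by omega] at hC
    rw [(hquad i hi).lie hb (by omega) (by omega) (hquad j hj) hC]
    congr 1
    push_cast
    ring
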